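/- arXiv:cs/0509064 — 3 statements merged into one kernel-verified Lean document; each statement's English description precedes it below -/
import Mathlib

section
/- Let (K, X, V, Y, Z) be finite-alphabet random variables whose joint law satisfies P_{KXVYZ}(k,x,v,y,z) = P_{KXVY}(k,x,v,y)P_{Z|Y}(z|y) for a fixed channel P_{Z|Y}. Then there exists a random variable V' taking values in an alphabet of cardinality at most |𝒦|·|𝒳|·|𝒴| + 1, jointly distributed with (K, X, Y) (and with Z generated from Y by P_{Z|Y}, conditionally independent of (K,X,V') given Y), such that the marginal distribution of (K, X, Y) is unchanged, I(V';Z|K) − I(V';X|K) = I(V;Z|K) − I(V;X|K), and I(X;Y,V'|K) = I(X;Y,V|K). Consequently Ed(X,Y), H(K|Y), and I(K;Y) are also preserved. -/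
open Finset

noncomputable section

namespace JWE

variable {Ω α β γ : Type*}

/-- Probability that the random variable `f` takes the value `a`, under the pmf `μ`. -/
def prEq [Fintype Ω] [DecidableEq α] (μ : Ω → ℝ) (f : Ω → α) (a : α) : ℝ :=
  ∑ ω, if f ω = a then μ ω else 0

/-- `μ` is a probability mass function on the finite type `Ω`. -/
def IsPMF [Fintype Ω] (μ : Ω → ℝ) : Prop :=
  (∀ ω, 0 ≤ μ ω) ∧ ∑ ω, μ ω = 1

/-- Shannon entropy (in bits) of the random variable `f` under `μ`. -/
def ent [Fintype Ω] [Fintype α] [DecidableEq α] (μ : Ω → ℝ) (f : Ω → α) : ℝ :=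
  -∑ a, prEq μ f a * Real.logb 2 (prEq μ f a)

/-- Shannon entropy (in bits) of a pmf `p` on a finite alphabet. -/
def entPMF [Fintype α] (p : α → ℝ) : ℝ :=
  -∑ a, p a * Real.logb 2 (p a)

/-- Conditional entropy H(f | g) under `μ`. -/
def condEnt [Fintype Ω] [Fintype α] [DecidableEq α] [Fintype β] [DecidableEq β]
    (μ : Ω → ℝ) (f : Ω → α) (g : Ω → β) : ℝ :=
  ent μ (fun ω => (f ω, g ω)) - ent μ g

/-- Mutual information I(f ; g) under `μ`. -/
def mutInf [Fintype Ω] [Fintype α] [DecidableEq α] [Fintype β] [DecidableEq β]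
    (μ : Ω → ℝ) (f : Ω → α) (g : Ω → β) : ℝ :=
  ent μ f + ent μ g - ent μ (fun ω => (f ω, g ω))

/-- Conditional mutual information I(f ; g | h) under `μ`. -/
def condMutInf [Fintype Ω] [Fintype α] [DecidableEq α] [Fintype β] [DecidableEq β]
    [Fintype γ] [DecidableEq γ] (μ : Ω → ℝ) (f : Ω → α) (g : Ω → β) (h : Ω → γ) : ℝ :=
  condEnt μ f h - condEnt μ f (fun ω => (g ω, h ω))

/-- Expected distortion E d(f, g) under `μ`. -/
def expDist [Fintype Ω] (μ : Ω → ℝ) (d : α → β → ℝ) (f : Ω → α) (g : Ω → β) : ℝ :=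
  ∑ ω, μ ω * d (f ω) (g ω)

/-- `W` is a channel (conditional pmf) from `α` to `β`. -/
def IsChannel [Fintype β] (W : α → β → ℝ) : Prop :=
  (∀ a b, 0 ≤ W a b) ∧ ∀ a, ∑ b, W a b = 1

/-- `f` and `g` are independent under `μ`. -/
def IndepRV [Fintype Ω] [DecidableEq α] [DecidableEq β]
    (μ : Ω → ℝ) (f : Ω → α) (g : Ω → β) : Prop :=
  ∀ a b, prEq μ (fun ω => (f ω, g ω)) (a, b) = prEq μ f a * prEq μ g b

/-- `f` and `g` are conditionally independent given `h` under `μ`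
(equivalently, `f → h → g` is a Markov chain). -/
def CondIndep [Fintype Ω] [DecidableEq α] [DecidableEq β] [DecidableEq γ]
    (μ : Ω → ℝ) (f : Ω → α) (g : Ω → β) (h : Ω → γ) : Prop :=
  ∀ a b c, prEq μ (fun ω => ((f ω, g ω), h ω)) ((a, b), c) * prEq μ h c =
    prEq μ (fun ω => (f ω, h ω)) (a, c) * prEq μ (fun ω => (g ω, h ω)) (b, c)

/-- The coordinates of the random vector `f` are i.i.d. with single-letter law `q`. -/
def IIDWithLaw [Fintype Ω] [DecidableEq α] {n : ℕ}
    (μ : Ω → ℝ) (f : Ω → Fin n → α) (q : α → ℝ) : Prop :=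
  ∀ v : Fin n → α, prEq μ f v = ∏ t, q (v t)

/-- Rate–distortion function of the source `pU` with respect to the distortion measure `d'`. -/
def RU {U Uh : Type*} [Fintype U] [DecidableEq U] [Fintype Uh] [DecidableEq Uh]
    (pU : U → ℝ) (d' : U → Uh → ℝ) (D' : ℝ) : ℝ :=
  sInf { r : ℝ | ∃ W : U → Uh → ℝ, IsChannel W ∧
    (∑ u, ∑ uh, pU u * W u uh * d' u uh) ≤ D' ∧
    r = mutInf (fun p : U × Uh => pU p.1 * W p.1 p.2) Prod.fst Prod.snd }

end JWE

open JWE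

section Caratheodory

/-- The Fenchel–Eggleston strengthening of Carathéodory's theorem: a point of the convex hull of
a preconnected subset of an affine hyperplane missing the origin is a nonnegative combination of
fewer points of the set than the dimension of the ambient space. -/
theorem exists_sum_smul_eq_of_mem_convexHull_of_isPreconnected {E : Type*}
    [NormedAddCommGroup E] [NormedSpace ℝ E] [FiniteDimensional ℝ E] {S : Set E}
    (hS : IsPreconnected S) (φ : E →ₗ[ℝ] ℝ) (hφ : ∀ s ∈ S, φ s = 1)
    (hd : 2 ≤ Module.finrank ℝ E) {x : E} (hx : x ∈ convexHull ℝ S) :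
    ∃ m : ℕ, m + 1 ≤ Module.finrank ℝ E ∧ ∃ (z : Fin m → E) (w : Fin m → ℝ),
      (∀ i, z i ∈ S) ∧ (∀ i, 0 ≤ w i) ∧ ∑ i, w i • z i = x := by
  classical
  suffices h : ∃ (ι : Type _) (_ : Fintype ι), Fintype.card ι + 1 ≤ Module.finrank ℝ E ∧
      ∃ (z : ι → E) (w : ι → ℝ),
        (∀ i, z i ∈ S) ∧ (∀ i, 0 ≤ w i) ∧ ∑ i, w i • z i = x by
    obtain ⟨ι, _, hc, z, w, hz, hw, hs⟩ := h
    refine ⟨Fintype.card ι, hc, z ∘ (Fintype.equivFin ι).symm, w ∘ (Fintype.equivFin ι).symm,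
      fun i => hz _, fun i => hw _, ?_⟩
    rw [← hs]
    exact Equiv.sum_comp (Fintype.equivFin ι).symm fun i => w i • z i
  obtain ⟨ι, _, z, c, hzS, hz, hc, -, hx⟩ := eq_pos_convex_span_of_mem_convexHull hx
  replace hzS : ∀ i, z i ∈ S := fun i => hzS ⟨i, rfl⟩
  have hli : LinearIndependent ℝ z := by
    rw [Fintype.linearIndependent_iff]
    intro g hg i
    have h0 : ∑ i, g i = 0 := by
      have := congrArg φ hg
      simpa [map_sum, hφ _ (hzS _)] using this
    exact (affineIndependent_iff.1 hz) Finset.univ g h0 hg i (Finset.mem_univ i)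
  rcases hli.fintype_card_le_finrank.lt_or_eq with hlt | heq
  · exact ⟨ι, inferInstance, hlt, z, c, hzS, fun i => (hc i).le, hx⟩
  obtain ⟨i₀, i₁, h01⟩ : ∃ i₀ i₁ : ι, i₀ ≠ i₁ :=
    Fintype.exists_pair_of_one_lt_card (by omega)
  have : Nonempty ι := ⟨i₀⟩
  let b := basisOfLinearIndependentOfCardEqFinrank hli heq
  have hb : ∀ i, b i = z i := fun i => by simp [b]
  let g : ι → E → ℝ := fun i s => b.repr s i / c i
  have hg : ∀ i, Continuous (g i) := fun i =>
    ((b.coord i).continuous_of_finiteDimensional).div_const _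
  have hgz : ∀ i j, g i (z j) = if i = j then (c i)⁻¹ else 0 := by
    intro i j
    simp only [g, ← hb, Module.Basis.repr_self, Finsupp.single_apply]
    split_ifs with h1 h2 h2 <;> simp_all
  have hne : (Finset.univ.erase i₀).Nonempty := ⟨i₁, by simp [h01.symm]⟩
  -- a point whose largest rescaled coordinate is attained at `i₀` and at another index
  obtain ⟨s, hsS, hs⟩ : ∃ s ∈ S, (Finset.univ.erase i₀).sup' hne (fun i => g i s) = g i₀ s := by
    refine hS.intermediate_value₂ (hzS i₀) (hzS i₁) ?_ (hg i₀).continuousOn ?_ ?_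
    · exact (Continuous.finset_sup'_apply hne fun i _ => hg i).continuousOn
    · refine Finset.sup'_le _ _ fun i hi => ?_
      rw [hgz, hgz, if_neg (Finset.ne_of_mem_erase hi), if_pos rfl]
      exact (inv_pos.2 (hc i₀)).le
    · refine le_trans ?_ (Finset.le_sup' (fun i => g i (z i₁)) (b := i₁) (by simp [h01.symm]))
      rw [hgz, hgz, if_neg h01, if_pos rfl]
      exact (inv_pos.2 (hc i₁)).le
  obtain ⟨j, hj, hjs⟩ := Finset.exists_mem_eq_sup' hne (fun i => g i s)
  rw [hs] at hjs
  have hj0 : j ≠ i₀ := Finset.ne_of_mem_erase hj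
  have hmax : ∀ i, g i s ≤ g i₀ s := by
    intro i
    by_cases hi : i = i₀
    · rw [hi]
    · rw [← hs]
      exact Finset.le_sup' (fun i => g i s) (by simp [hi])
  have hsum : ∑ i, b.repr s i • z i = s := by simpa [hb] using b.sum_repr s
  have hpos : 0 < g i₀ s := by
    by_contra! hle
    have h1 : ∑ i, b.repr s i = 1 := by
      have := congrArg φ hsum
      simpa [map_sum, hφ _ (hzS _), hφ s hsS] using this
    have h2 : ∑ i, b.repr s i ≤ 0 := Finset.sum_nonpos fun i _ => by
      have := (hmax i).trans hle
      simpa using (div_le_iff₀ (hc i)).1 this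
    linarith
  set μ := (g i₀ s)⁻¹ with hμ
  have hμ0 : 0 < μ := inv_pos.2 hpos
  have hrepr : ∀ i, b.repr s i = g i s * c i := fun i => by
    simp only [g]; rw [div_mul_cancel₀ _ (hc i).ne']
  have hnonneg : ∀ i, 0 ≤ c i - μ * b.repr s i := by
    intro i
    have h1 : μ * g i s ≤ 1 := by
      rw [hμ, inv_mul_le_iff₀ hpos, mul_one]; exact hmax i
    rw [hrepr]
    nlinarith [hc i]
  have hzero : ∀ i, g i s = g i₀ s → c i - μ * b.repr s i = 0 := by
    intro i hi
    rw [hrepr, hi, hμ, inv_mul_cancel_left₀ hpos.ne', sub_self]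
  refine ⟨{i // i ≠ j}, inferInstance, ?_, fun i => if i.1 = i₀ then s else z i.1,
    fun i => if i.1 = i₀ then μ else c i.1 - μ * b.repr s i.1, ?_, ?_, ?_⟩
  · have : Fintype.card {i // i ≠ j} < Fintype.card ι :=
      Fintype.card_subtype_lt (x := j) (by simp)
    omega
  · intro i
    dsimp only
    split_ifs
    exacts [hsS, hzS _]
  · intro i
    dsimp only
    split_ifs
    exacts [hμ0.le, hnonneg _]
  · let F : ι → E := fun i =>
      (c i - μ * b.repr s i) • z i + if i = i₀ then μ • s else 0
    have hF : ∀ i : {i // i ≠ j}, ((if i.1 = i₀ then μ else c i.1 - μ * b.repr s i.1) •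
        (if i.1 = i₀ then s else z i.1)) = F i.1 := by
      intro i
      simp only [F]
      split_ifs with hi
      · rw [hi, hzero i₀ rfl, zero_smul, zero_add]
      · rw [add_zero]
    have hFj : F j = 0 := by simp [F, hzero j hjs.symm, hj0]
    rw [Finset.sum_congr rfl fun i _ => hF i]
    have h1 : ∑ i : {i // i ≠ j}, F i.1 = ∑ i, F i := by
      rw [← Finset.sum_subtype (Finset.univ.erase j) (by simp) F,
        Finset.sum_erase _ hFj]
    rw [h1, Finset.sum_add_distrib, Finset.sum_ite_eq' Finset.univ i₀ (fun _ => μ • s)]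
    simp only [sub_smul, mul_smul, Finset.sum_sub_distrib, ← Finset.smul_sum, hsum, hx,
      Finset.mem_univ, if_true, sub_add_cancel]

end Caratheodory

namespace JWE

section Entropy

theorem prEq_smul {Ω α : Type*} [Fintype Ω] [DecidableEq α] (c : ℝ) (μ : Ω → ℝ)
    (f : Ω → α) (a : α) :
    prEq (fun ω => c * μ ω) f a = c * prEq μ f a := by
  simp only [prEq, Finset.mul_sum, mul_ite, mul_zero]

variable {Ω Ω' α β : Type*} [Fintype Ω] [Fintype Ω'] [Fintype α] [DecidableEq α]
  [Fintype β] [DecidableEq β]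

theorem ent_congr {μ : Ω → ℝ} {ν : Ω' → ℝ} {f : Ω → α} {g : Ω' → α}
    (h : ∀ a, prEq μ f a = prEq ν g a) : ent μ f = ent ν g := by
  simp only [ent, h]

theorem ent_equiv_comp (μ : Ω → ℝ) (f : Ω → α) (e : α ≃ β) :
    ent μ (fun ω => e (f ω)) = ent μ f := by
  simp only [ent, prEq]
  rw [← Equiv.sum_comp e]
  simp

theorem sum_prEq (μ : Ω → ℝ) (f : Ω → α) : ∑ a, prEq μ f a = ∑ ω, μ ω := by
  simp only [prEq]
  rw [Finset.sum_comm]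
  simp

theorem ent_smul (c : ℝ) (μ : Ω → ℝ) (f : Ω → α) :
    ent (fun ω => c * μ ω) f = c * ent μ f - c * Real.logb 2 c * ∑ ω, μ ω := by
  have key : ∀ a, c * prEq μ f a * Real.logb 2 (c * prEq μ f a) =
      c * (prEq μ f a * Real.logb 2 (prEq μ f a)) + c * Real.logb 2 c * prEq μ f a := by
    intro a
    rcases eq_or_ne c 0 with rfl | hc
    · simp
    rcases eq_or_ne (prEq μ f a) 0 with h | h
    · simp [h]
    rw [Real.logb_mul hc h]
    ring
  simp only [ent, prEq_smul, key, Finset.sum_add_distrib, ← Finset.mul_sum, sum_prEq]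
  ring

theorem continuous_ent (f : Ω → α) : Continuous fun μ : Ω → ℝ => ent μ f := by
  have h : Continuous fun t : ℝ => t * Real.logb 2 t := by
    simp only [Real.logb, ← mul_div_assoc]
    exact Real.continuous_mul_log.div_const _
  refine (continuous_finsetSum _ fun a _ => h.comp ?_).neg
  refine continuous_finsetSum _ fun ω _ => ?_
  split_ifs
  exacts [continuous_apply ω, continuous_const]

end Entropy

section Slice

variable {𝒦 𝒳 𝒱 𝒴 𝒵 α β : Type*} [Fintype 𝒦] [Fintype 𝒳] [Fintype 𝒱]
  [Fintype 𝒴] [Fintype 𝒵] [Fintype α] [DecidableEq α]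

/-- The part of a joint law of `(K, X, V, Y, Z)` lying over `V = v`. -/
def slice (p : 𝒦 × 𝒳 × 𝒱 × 𝒴 × 𝒵 → ℝ) (v : 𝒱) : 𝒦 × 𝒳 × 𝒴 × 𝒵 → ℝ :=
  fun ω => p (ω.1, ω.2.1, v, ω.2.2.1, ω.2.2.2)

/-- Passing a (not necessarily normalised) law of `(K, X, Y)` through the channel `PZ`. -/
def extend (PZ : 𝒴 → 𝒵 → ℝ) (r : 𝒦 × 𝒳 × 𝒴 → ℝ) : 𝒦 × 𝒳 × 𝒴 × 𝒵 → ℝ :=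
  fun ω => r (ω.1, ω.2.1, ω.2.2.1) * PZ ω.2.2.1 ω.2.2.2

/-- Forgetting the coordinate `V`. -/
def dropV (ω : 𝒦 × 𝒳 × 𝒱 × 𝒴 × 𝒵) : 𝒦 × 𝒳 × 𝒴 × 𝒵 :=
  (ω.1, ω.2.1, ω.2.2.2.1, ω.2.2.2.2)

theorem sum_eq_sum_slice {M : Type*} [AddCommMonoid M] (F : 𝒦 × 𝒳 × 𝒱 × 𝒴 × 𝒵 → M) :
    ∑ ω, F ω = ∑ v, ∑ ω : 𝒦 × 𝒳 × 𝒴 × 𝒵, F (ω.1, ω.2.1, v, ω.2.2.1, ω.2.2.2) := by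
  let e : 𝒦 × 𝒳 × 𝒱 × 𝒴 × 𝒵 ≃ 𝒱 × 𝒦 × 𝒳 × 𝒴 × 𝒵 :=
    { toFun := fun ω => (ω.2.2.1, ω.1, ω.2.1, ω.2.2.2.1, ω.2.2.2.2)
      invFun := fun ω => (ω.2.1, ω.2.2.1, ω.1, ω.2.2.2.1, ω.2.2.2.2)
      left_inv := fun _ => rfl
      right_inv := fun _ => rfl }
  rw [← Equiv.sum_comp e.symm, Fintype.sum_prod_type]
  rfl

theorem ent_dropV (p : 𝒦 × 𝒳 × 𝒱 × 𝒴 × 𝒵 → ℝ) (g : 𝒦 × 𝒳 × 𝒴 × 𝒵 → α) :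
    ent p (fun ω => g (dropV ω)) = ent (fun ω => ∑ v, slice p v ω) g := by
  refine ent_congr fun a => ?_
  simp only [prEq, sum_eq_sum_slice (𝒱 := 𝒱), dropV, slice]
  rw [Finset.sum_comm]
  refine Finset.sum_congr rfl fun ω _ => ?_
  by_cases h : g ω = a <;> simp [h]

theorem ent_dropV_congr {𝒱' : Type*} [Fintype 𝒱'] {p : 𝒦 × 𝒳 × 𝒱 × 𝒴 × 𝒵 → ℝ}
    {q : 𝒦 × 𝒳 × 𝒱' × 𝒴 × 𝒵 → ℝ}
    (h : (fun ω => ∑ v, slice q v ω) = fun ω => ∑ v, slice p v ω)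
    (g : 𝒦 × 𝒳 × 𝒴 × 𝒵 → α) :
    ent q (fun ω => g (dropV ω)) = ent p (fun ω => g (dropV ω)) := by
  rw [ent_dropV, ent_dropV, h]

theorem ent_pair_dropV [DecidableEq 𝒱] (p : 𝒦 × 𝒳 × 𝒱 × 𝒴 × 𝒵 → ℝ) (g : 𝒦 × 𝒳 × 𝒴 × 𝒵 → α) :
    ent p (fun ω => (ω.2.2.1, g (dropV ω))) = ∑ v, ent (slice p v) g := by
  have h : ∀ v a, prEq p (fun ω => (ω.2.2.1, g (dropV ω))) (v, a) = prEq (slice p v) g a := by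
    intro v a
    simp only [prEq, sum_eq_sum_slice (𝒱 := 𝒱), dropV, slice, Prod.mk.injEq]
    rw [Finset.sum_eq_single v (fun v' _ hv => by simp [hv]) (by simp)]
    simp
  simp only [ent, Fintype.sum_prod_type, h, Finset.sum_neg_distrib]

theorem condMutInf_sub_condMutInf_eq [DecidableEq 𝒦] [DecidableEq 𝒳] [DecidableEq 𝒱]
    [DecidableEq 𝒵]
    (p : 𝒦 × 𝒳 × 𝒱 × 𝒴 × 𝒵 → ℝ) :
    condMutInf p (fun ω => ω.2.2.1) (fun ω => ω.2.2.2.2) (fun ω => ω.1)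
        - condMutInf p (fun ω => ω.2.2.1) (fun ω => ω.2.1) (fun ω => ω.1) =
      ent (fun ω => ∑ v, slice p v ω) (fun ω => (ω.2.2.2, ω.1))
        - ent (fun ω => ∑ v, slice p v ω) (fun ω => (ω.2.1, ω.1))
        + ∑ v, (ent (slice p v) (fun ω => (ω.2.1, ω.1))
          - ent (slice p v) (fun ω => (ω.2.2.2, ω.1))) := by
  rw [Finset.sum_sub_distrib, ← ent_dropV, ← ent_dropV, ← ent_pair_dropV, ← ent_pair_dropV]
  simp only [condMutInf, condEnt, dropV]
  ring

theorem condMutInf_pair_eq [DecidableEq 𝒦] [DecidableEq 𝒳] [DecidableEq 𝒱]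
    [DecidableEq 𝒴]
    (p : 𝒦 × 𝒳 × 𝒱 × 𝒴 × 𝒵 → ℝ) :
    condMutInf p (fun ω => ω.2.1) (fun ω => (ω.2.2.2.1, ω.2.2.1)) (fun ω => ω.1) =
      ent (fun ω => ∑ v, slice p v ω) (fun ω => (ω.2.1, ω.1))
        - ent (fun ω => ∑ v, slice p v ω) (fun ω => ω.1)
        + ∑ v, (ent (slice p v) (fun ω => (ω.2.2.1, ω.1))
          - ent (slice p v) (fun ω => (ω.2.1, ω.2.2.1, ω.1))) := by
  rw [Finset.sum_sub_distrib, ← ent_dropV, ← ent_dropV, ← ent_pair_dropV, ← ent_pair_dropV]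
  let e₁ : 𝒱 × 𝒴 × 𝒦 ≃ (𝒴 × 𝒱) × 𝒦 :=
    { toFun := fun t => ((t.2.1, t.1), t.2.2)
      invFun := fun t => (t.1.2, t.1.1, t.2)
      left_inv := fun _ => rfl
      right_inv := fun _ => rfl }
  let e₂ : 𝒱 × 𝒳 × 𝒴 × 𝒦 ≃ 𝒳 × (𝒴 × 𝒱) × 𝒦 :=
    { toFun := fun t => (t.2.1, (t.2.2.1, t.1), t.2.2.2)
      invFun := fun t => (t.2.1.2, t.1, t.2.1.1, t.2.2)
      left_inv := fun _ => rfl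
      right_inv := fun _ => rfl }
  rw [← ent_equiv_comp p _ e₁, ← ent_equiv_comp p _ e₂]
  simp only [condMutInf, condEnt, dropV, e₁, e₂, Equiv.coe_fn_mk]
  ring

theorem expDist_eq (p : 𝒦 × 𝒳 × 𝒱 × 𝒴 × 𝒵 → ℝ) (d : 𝒳 → 𝒴 → ℝ) :
    expDist p d (fun ω => ω.2.1) (fun ω => ω.2.2.2.1) =
      ∑ ω : 𝒦 × 𝒳 × 𝒴 × 𝒵, (∑ v, slice p v ω) * d ω.2.1 ω.2.2.1 := by
  simp only [expDist, sum_eq_sum_slice (𝒱 := 𝒱), slice, Finset.sum_mul]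
  exact Finset.sum_comm

/-- The difference of the entropies of two functions of `(K, X, Y, Z)` when `(K, X, Y)` has the
(not necessarily normalised) law `r`. -/
def entDiff [Fintype β] [DecidableEq β] (PZ : 𝒴 → 𝒵 → ℝ) (f : 𝒦 × 𝒳 × 𝒴 × 𝒵 → α)
    (g : 𝒦 × 𝒳 × 𝒴 × 𝒵 → β) (r : 𝒦 × 𝒳 × 𝒴 → ℝ) : ℝ :=
  ent (extend PZ r) f - ent (extend PZ r) g

theorem entDiff_smul [Fintype β] [DecidableEq β] (PZ : 𝒴 → 𝒵 → ℝ) (f : 𝒦 × 𝒳 × 𝒴 × 𝒵 → α)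
    (g : 𝒦 × 𝒳 × 𝒴 × 𝒵 → β) (c : ℝ) (r : 𝒦 × 𝒳 × 𝒴 → ℝ) :
    entDiff PZ f g (c • r) = c * entDiff PZ f g r := by
  have h : extend PZ (c • r) = fun ω => c * extend PZ r ω := by
    funext ω
    simp [extend, mul_assoc]
  rw [entDiff, entDiff, h, ent_smul, ent_smul]
  ring

theorem continuous_entDiff [Fintype β] [DecidableEq β] (PZ : 𝒴 → 𝒵 → ℝ)
    (f : 𝒦 × 𝒳 × 𝒴 × 𝒵 → α) (g : 𝒦 × 𝒳 × 𝒴 × 𝒵 → β) : Continuous (entDiff PZ f g) := by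
  have h : Continuous (extend PZ : (𝒦 × 𝒳 × 𝒴 → ℝ) → 𝒦 × 𝒳 × 𝒴 × 𝒵 → ℝ) :=
    continuous_pi fun ω => (continuous_apply _).mul continuous_const
  exact ((continuous_ent f).comp h).sub ((continuous_ent g).comp h)

end Slice

section SupportLemma

/-- The support lemma for two continuous, positively homogeneous functionals of unnormalised laws
on a finite nonempty alphabet `A`: a finite family of such laws, of total mass one, may be replaced
by one with at most `|A| + 1` members having the same sum and the same sums of the functionals. -/
theorem exists_family_card_le {A V : Type*} [Fintype A] [Fintype V] [Nonempty A]
    {F G : (A → ℝ) → ℝ} (hF : Continuous F) (hG : Continuous G)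
    (hFs : ∀ (c : ℝ) r, F (c • r) = c * F r) (hGs : ∀ (c : ℝ) r, G (c • r) = c * G r)
    (a : V → A → ℝ) (ha : ∀ v i, 0 ≤ a v i) (ha1 : ∑ v, ∑ i, a v i = 1) :
    ∃ m : ℕ, m ≤ Fintype.card A + 1 ∧ ∃ b : Fin m → A → ℝ, (∀ j i, 0 ≤ b j i) ∧
      ∑ j, b j = ∑ v, a v ∧ ∑ j, F (b j) = ∑ v, F (a v) ∧ ∑ j, G (b j) = ∑ v, G (a v) := by
  classical
  let Φ : (A → ℝ) → (A → ℝ) × ℝ × ℝ := fun r => (r, F r, G r)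
  have hΦ : Continuous Φ := continuous_id.prodMk (hF.prodMk hG)
  have hΦs : ∀ (c : ℝ) r, Φ (c • r) = c • Φ r := fun c r => by
    simp [Φ, hFs, hGs]
  let φ : ((A → ℝ) × ℝ × ℝ) →ₗ[ℝ] ℝ :=
    (∑ i, LinearMap.proj i) ∘ₗ LinearMap.fst ℝ (A → ℝ) (ℝ × ℝ)
  have hφ : ∀ s ∈ Φ '' stdSimplex ℝ A, φ s = 1 := by
    rintro _ ⟨r, hr, rfl⟩
    simpa [φ, Φ] using hr.2
  have hS : IsPreconnected (Φ '' stdSimplex ℝ A) :=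
    (convex_stdSimplex ℝ A).isPreconnected.image Φ hΦ.continuousOn
  have hdim : Module.finrank ℝ ((A → ℝ) × ℝ × ℝ) = Fintype.card A + 2 := by
    simp [Module.finrank_prod]
  have hmem : ∑ v, Φ (a v) ∈ convexHull ℝ (Φ '' stdSimplex ℝ A) := by
    obtain ⟨i₀⟩ := ‹Nonempty A›
    let r : V → A → ℝ := fun v =>
      if ∑ i, a v i = 0 then Pi.single i₀ 1 else (∑ i, a v i)⁻¹ • a v
    have hW : ∀ v, 0 ≤ ∑ i, a v i := fun v => Finset.sum_nonneg fun i _ => ha v i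
    have hr : ∀ v, r v ∈ stdSimplex ℝ A := by
      intro v
      simp only [r]
      split_ifs with h
      · exact single_mem_stdSimplex ℝ i₀
      · refine ⟨fun i => mul_nonneg (inv_nonneg.2 (hW v)) (ha v i), ?_⟩
        simp only [Pi.smul_apply, smul_eq_mul, ← Finset.mul_sum]
        exact inv_mul_cancel₀ h
    have har : ∀ v, a v = (∑ i, a v i) • r v := by
      intro v
      simp only [r]
      split_ifs with h
      · rw [h, zero_smul]
        funext i
        exact (Finset.sum_eq_zero_iff_of_nonneg fun i _ => ha v i).1 h i (Finset.mem_univ i)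
      · rw [smul_inv_smul₀ h]
    have : ∑ v, Φ (a v) = ∑ v, (∑ i, a v i) • Φ (r v) :=
      Finset.sum_congr rfl fun v _ => by rw [← hΦs, ← har]
    rw [this]
    exact (convex_convexHull ℝ _).sum_mem (fun v _ => hW v) ha1
      fun v _ => subset_convexHull ℝ _ ⟨r v, hr v, rfl⟩
  obtain ⟨m, hm, z, w, hz, hw, hsum⟩ :=
    exists_sum_smul_eq_of_mem_convexHull_of_isPreconnected hS φ hφ (by omega) hmem
  choose r hr hrz using hz
  have hsum' : ∑ j, Φ (w j • r j) = ∑ v, Φ (a v) := by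
    rw [← hsum]
    exact Finset.sum_congr rfl fun j _ => by rw [hΦs, hrz]
  refine ⟨m, by omega, fun j => w j • r j, fun j i => mul_nonneg (hw j) ((hr j).1 i), ?_, ?_, ?_⟩
  · simpa [Φ, Prod.fst_sum] using congrArg Prod.fst hsum'
  · simpa [Φ, Prod.fst_sum, Prod.snd_sum] using congrArg (fun t => t.2.1) hsum'
  · simpa [Φ, Prod.fst_sum, Prod.snd_sum] using congrArg (fun t => t.2.2) hsum'

end SupportLemma

end JWE

/-- support lemma / cardinality reduction: if the joint law of (K,X,V,Y,Z)
factors as P_{KXVY}·P_{Z|Y}, then there is a random variable V' on an alphabet of size at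
most |𝒦|·|𝒳|·|𝒴| + 1 (jointly distributed with (K,X,Y), with Z still generated from Y via
P_{Z|Y}) preserving the (K,X,Y) marginal, the quantity I(V;Z|K) − I(V;X|K), and
I(X;Y,V|K); consequently E d(X,Y), H(K|Y) and I(K;Y) are preserved as well. -/
theorem statement8 {𝒦 𝒳 𝒱 𝒴 𝒵 : Type*}
    [Fintype 𝒦] [DecidableEq 𝒦] [Fintype 𝒳] [DecidableEq 𝒳]
    [Fintype 𝒱] [DecidableEq 𝒱] [Fintype 𝒴] [DecidableEq 𝒴]
    [Fintype 𝒵] [DecidableEq 𝒵]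
    (p : 𝒦 × 𝒳 × 𝒱 × 𝒴 × 𝒵 → ℝ) (hp : IsPMF p)
    (PZ : 𝒴 → 𝒵 → ℝ) (hPZ : IsChannel PZ)
    (hfact : ∀ k x v y z, p (k, x, v, y, z) = (∑ z', p (k, x, v, y, z')) * PZ y z)
    (d : 𝒳 → 𝒴 → ℝ) :
    ∃ m : ℕ, m ≤ Fintype.card 𝒦 * Fintype.card 𝒳 * Fintype.card 𝒴 + 1 ∧
    ∃ q : 𝒦 × 𝒳 × Fin m × 𝒴 × 𝒵 → ℝ, IsPMF q ∧
      (∀ k x v y z, q (k, x, v, y, z) = (∑ z', q (k, x, v, y, z')) * PZ y z) ∧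
      (∀ k x y, (∑ v, ∑ z, q (k, x, v, y, z)) = ∑ v, ∑ z, p (k, x, v, y, z)) ∧
      condMutInf q (fun ω => ω.2.2.1) (fun ω => ω.2.2.2.2) (fun ω => ω.1)
          - condMutInf q (fun ω => ω.2.2.1) (fun ω => ω.2.1) (fun ω => ω.1)
        = condMutInf p (fun ω => ω.2.2.1) (fun ω => ω.2.2.2.2) (fun ω => ω.1)
          - condMutInf p (fun ω => ω.2.2.1) (fun ω => ω.2.1) (fun ω => ω.1) ∧
      condMutInf q (fun ω => ω.2.1) (fun ω => (ω.2.2.2.1, ω.2.2.1)) (fun ω => ω.1)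
        = condMutInf p (fun ω => ω.2.1) (fun ω => (ω.2.2.2.1, ω.2.2.1)) (fun ω => ω.1) ∧
      expDist q d (fun ω => ω.2.1) (fun ω => ω.2.2.2.1)
        = expDist p d (fun ω => ω.2.1) (fun ω => ω.2.2.2.1) ∧
      condEnt q (fun ω => ω.1) (fun ω => ω.2.2.2.1)
        = condEnt p (fun ω => ω.1) (fun ω => ω.2.2.2.1) ∧
      mutInf q (fun ω => ω.1) (fun ω => ω.2.2.2.1)
        = mutInf p (fun ω => ω.1) (fun ω => ω.2.2.2.1) := by
  obtain ⟨hp0, hp1⟩ := hp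
  obtain ⟨hP0, hP1⟩ := hPZ
  have hne : Nonempty (𝒦 × 𝒳 × 𝒴) := by
    by_contra h
    have : IsEmpty (𝒦 × 𝒳 × 𝒱 × 𝒴 × 𝒵) := ⟨fun ω => h ⟨(ω.1, ω.2.1, ω.2.2.2.1)⟩⟩
    simp at hp1
  let a : 𝒱 → 𝒦 × 𝒳 × 𝒴 → ℝ := fun v t => ∑ z, p (t.1, t.2.1, v, t.2.2, z)
  have hpa : ∀ v, slice p v = extend PZ (a v) := fun v => funext fun ω => hfact _ _ _ _ _
  have ha1 : ∑ v, ∑ t, a v t = 1 := by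
    rw [← hp1, sum_eq_sum_slice]
    simp only [a, Fintype.sum_prod_type]
  obtain ⟨m, hm, b, hb0, hb, hF, hG⟩ := exists_family_card_le
    (continuous_entDiff PZ (fun ω : 𝒦 × 𝒳 × 𝒴 × 𝒵 => (ω.2.1, ω.1)) fun ω => (ω.2.2.2, ω.1))
    (continuous_entDiff PZ (fun ω : 𝒦 × 𝒳 × 𝒴 × 𝒵 => (ω.2.2.1, ω.1))
      fun ω => (ω.2.1, ω.2.2.1, ω.1))
    (entDiff_smul PZ _ _) (entDiff_smul PZ _ _) a
    (fun v t => Finset.sum_nonneg fun z _ => hp0 _) ha1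
  let q : 𝒦 × 𝒳 × Fin m × 𝒴 × 𝒵 → ℝ := fun ω =>
    b ω.2.2.1 (ω.1, ω.2.1, ω.2.2.2.1) * PZ ω.2.2.2.1 ω.2.2.2.2
  have hqb : ∀ j, slice q j = extend PZ (b j) := fun j => rfl
  have hqz : ∀ k x j y, ∑ z, q (k, x, j, y, z) = b j (k, x, y) := fun k x j y => by
    simp only [q, ← Finset.mul_sum, hP1, mul_one]
  have hb' : ∀ t, ∑ j, b j t = ∑ v, a v t := fun t => by
    simpa using congrFun hb t
  have hslice : (fun ω => ∑ j, slice q j ω) = fun ω => ∑ v, slice p v ω := by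
    funext ω
    simp only [hqb, hpa, extend, ← Finset.sum_mul, hb']
  have hK := ent_dropV_congr hslice fun ω => ω.1
  have hY := ent_dropV_congr hslice fun ω => ω.2.2.1
  have hKY := ent_dropV_congr hslice fun ω => (ω.1, ω.2.2.1)
  simp only [dropV] at hK hY hKY
  refine ⟨m, ?_, q, ⟨fun ω => mul_nonneg (hb0 _ _) (hP0 _ _), ?_⟩, ?_, ?_, ?_, ?_, ?_, ?_, ?_⟩
  · simpa [mul_assoc] using hm
  · rw [← ha1, sum_eq_sum_slice]
    simp only [Fintype.sum_prod_type, hqz]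
    have := congrArg (fun r : 𝒦 × 𝒳 × 𝒴 → ℝ => ∑ t, r t) (funext hb')
    rw [Finset.sum_comm (f := fun t j => b j t), Finset.sum_comm (f := fun t v => a v t)] at this
    simpa only [Fintype.sum_prod_type] using this
  · intro k x j y z
    rw [hqz]
  · intro k x y
    simp only [hqz]
    exact hb' (k, x, y)
  · rw [condMutInf_sub_condMutInf_eq, condMutInf_sub_condMutInf_eq, hslice]
    simp only [hqb, hpa]
    exact congrArg _ hF
  · rw [condMutInf_pair_eq, condMutInf_pair_eq, hslice]
    simp only [hqb, hpa]
    exact congrArg _ hG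
  · simp only [expDist_eq, congrFun hslice]
  · simp only [condEnt, hKY, hY]
  · simp only [mutInf, hK, hY, hKY]

end
end

section
/- Suppose U^N is independent of K^n and Z^n is conditionally independent of U^N given (Y^n, K^n) (i.e., given K^n, U^N → Y^n → Z^n is a Markov chain). Then H(Y^n|K^n) ≥ H(Y^n|U^N,K^n) + I(U^N;Z^n,K^n). -/
open Finset

noncomputable section

namespace JWE

variable {Ω α β γ : Type*}

lemma prodLeftComm_injective :
    Function.Injective fun v : α × β × γ => (v.2.1, v.1, v.2.2) := by
  rintro ⟨a, b, c⟩ ⟨a', b', c'⟩ h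
  simp_all

section EntropyLemmas

variable [Fintype Ω] [DecidableEq α] [DecidableEq β] [DecidableEq γ] {μ : Ω → ℝ}

lemma prEq_nonneg (hμ : ∀ ω, 0 ≤ μ ω) (f : Ω → α) (a : α) : 0 ≤ prEq μ f a :=
  Finset.sum_nonneg fun ω _ => by split_ifs <;> simp [hμ ω]

lemma prEq_apply_pos (hμ : ∀ ω, 0 ≤ μ ω) (f : Ω → α) {ω : Ω} (hω : 0 < μ ω) :
    0 < prEq μ f (f ω) := by
  refine Finset.sum_pos' (fun ω' _ => ?_) ⟨ω, Finset.mem_univ ω, by simpa using hω⟩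
  split_ifs <;> simp [hμ ω']

lemma prEq_comp_of_injective {e : α → β} (he : Function.Injective e) (f : Ω → α) (a : α) :
    prEq μ (fun ω => e (f ω)) (e a) = prEq μ f a := by
  simp [prEq, he.eq_iff]

lemma sum_prEq_mul [Fintype α] (f : Ω → α) (F : α → ℝ) :
    ∑ a, prEq μ f a * F a = ∑ ω, μ ω * F (f ω) := by
  simp only [prEq, Finset.sum_mul]
  rw [Finset.sum_comm]
  simp [ite_mul]

lemma sum_prEq_prod_mk [Fintype α] (f : Ω → α) (g : Ω → β) (b : β) :
    ∑ a, prEq μ (fun ω => (f ω, g ω)) (a, b) = prEq μ g b := by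
  simp only [prEq]
  rw [Finset.sum_comm]
  simp [Prod.mk.injEq, ite_and]

lemma ent_eq_sum [Fintype α] (f : Ω → α) :
    ent μ f = ∑ ω, μ ω * -Real.logb 2 (prEq μ f (f ω)) := by
  rw [ent, sum_prEq_mul f fun a => Real.logb 2 (prEq μ f a)]
  simp

lemma ent_comp_of_injective [Fintype α] [Fintype β] {e : α → β} (he : Function.Injective e)
    (f : Ω → α) : ent μ (fun ω => e (f ω)) = ent μ f := by
  simp only [ent_eq_sum, prEq_comp_of_injective he]

lemma IndepRV.ent_prodMk [Fintype α] [Fintype β] (hμ : ∀ ω, 0 ≤ μ ω) {f : Ω → α} {g : Ω → β}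
    (h : IndepRV μ f g) : ent μ (fun ω => (f ω, g ω)) = ent μ f + ent μ g := by
  simp only [ent_eq_sum, ← Finset.sum_add_distrib]
  refine Finset.sum_congr rfl fun ω _ => ?_
  rcases (hμ ω).eq_or_lt with hω | hω
  · simp [← hω]
  · rw [h, Real.logb_mul (prEq_apply_pos hμ f hω).ne' (prEq_apply_pos hμ g hω).ne']
    ring

lemma CondIndep.ent_add_ent [Fintype α] [Fintype β] [Fintype γ] (hμ : ∀ ω, 0 ≤ μ ω)
    {f : Ω → α} {g : Ω → β} {h : Ω → γ} (H : CondIndep μ f g h) :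
    ent μ (fun ω => ((f ω, g ω), h ω)) + ent μ h =
      ent μ (fun ω => (f ω, h ω)) + ent μ (fun ω => (g ω, h ω)) := by
  simp only [ent_eq_sum, ← Finset.sum_add_distrib]
  refine Finset.sum_congr rfl fun ω _ => ?_
  rcases (hμ ω).eq_or_lt with hω | hω
  · simp [← hω]
  · have hlog := congrArg (Real.logb 2) (H (f ω) (g ω) (h ω))
    rw [Real.logb_mul (prEq_apply_pos hμ (fun ω => ((f ω, g ω), h ω)) hω).ne'
        (prEq_apply_pos hμ h hω).ne',
      Real.logb_mul (prEq_apply_pos hμ (fun ω => (f ω, h ω)) hω).ne'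
        (prEq_apply_pos hμ (fun ω => (g ω, h ω)) hω).ne'] at hlog
    linear_combination -μ ω * hlog

lemma sum_prEq_mul_prEq_div [Fintype α] [Fintype β] [Fintype γ]
    (f : Ω → α) (g : Ω → β) (h : Ω → γ) :
    ∑ v : (α × β) × γ, prEq μ (fun ω => (f ω, h ω)) (v.1.1, v.2) *
      prEq μ (fun ω => (g ω, h ω)) (v.1.2, v.2) / prEq μ h v.2 = ∑ ω, μ ω := by
  rw [Fintype.sum_prod_type_right]
  simp only [Fintype.sum_prod_type, ← Finset.sum_div, ← Finset.sum_mul_sum, sum_prEq_prod_mk,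
    mul_self_div_self]
  simpa using sum_prEq_mul (μ := μ) h fun _ => 1

/-- Submodularity of Shannon entropy. -/
lemma ent_add_ent_le [Fintype α] [Fintype β] [Fintype γ] (hμ : ∀ ω, 0 ≤ μ ω)
    (f : Ω → α) (g : Ω → β) (h : Ω → γ) :
    ent μ (fun ω => ((f ω, g ω), h ω)) + ent μ h ≤
      ent μ (fun ω => (f ω, h ω)) + ent μ (fun ω => (g ω, h ω)) := by
  set p := prEq μ (fun ω => ((f ω, g ω), h ω)) with hp
  set q : (α × β) × γ → ℝ := fun v => prEq μ (fun ω => (f ω, h ω)) (v.1.1, v.2) *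
    prEq μ (fun ω => (g ω, h ω)) (v.1.2, v.2) / prEq μ h v.2 with hq
  have hq0 : ∀ v, 0 ≤ q v := fun v =>
    div_nonneg (mul_nonneg (prEq_nonneg hμ _ _) (prEq_nonneg hμ _ _)) (prEq_nonneg hμ _ _)
  have hsum : ∑ ω, μ ω * (q ((f ω, g ω), h ω) / p ((f ω, g ω), h ω)) ≤ ∑ ω, μ ω := by
    rw [← sum_prEq_mul (fun ω => ((f ω, g ω), h ω)) fun v => q v / p v,
      ← sum_prEq_mul_prEq_div f g h]
    refine Finset.sum_le_sum fun v _ => ?_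
    rcases eq_or_ne (p v) 0 with hv | hv
    · simpa [← hp, hv] using hq0 v
    · exact (mul_div_cancel₀ (q v) hv).le
  have hpt : ∀ ω, μ ω * ((1 - q ((f ω, g ω), h ω) / p ((f ω, g ω), h ω)) / Real.log 2) ≤
      μ ω * (Real.logb 2 (p ((f ω, g ω), h ω)) + Real.logb 2 (prEq μ h (h ω)) -
        Real.logb 2 (prEq μ (fun ω => (f ω, h ω)) (f ω, h ω)) -
        Real.logb 2 (prEq μ (fun ω => (g ω, h ω)) (g ω, h ω))) := by
    intro ω
    rcases (hμ ω).eq_or_lt with hω | hω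
    · simp [← hω]
    refine mul_le_mul_of_nonneg_left ?_ hω.le
    have hfgh := prEq_apply_pos hμ (fun ω => ((f ω, g ω), h ω)) hω
    have hfh := prEq_apply_pos hμ (fun ω => (f ω, h ω)) hω
    have hgh := prEq_apply_pos hμ (fun ω => (g ω, h ω)) hω
    have hh := prEq_apply_pos hμ h hω
    have hlog := Real.log_le_sub_one_of_pos (div_pos (div_pos (mul_pos hfh hgh) hh) hfgh)
    rw [Real.log_div (div_pos (mul_pos hfh hgh) hh).ne' hfgh.ne',
      Real.log_div (mul_pos hfh hgh).ne' hh.ne', Real.log_mul hfh.ne' hgh.ne'] at hlog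
    simp only [Real.logb, ← add_div, ← sub_div]
    refine div_le_div_of_nonneg_right ?_ (Real.log_pos one_lt_two).le
    simp only [hq, hp]
    linarith
  have hnonneg : 0 ≤ ∑ ω, μ ω *
      ((1 - q ((f ω, g ω), h ω) / p ((f ω, g ω), h ω)) / Real.log 2) := by
    simp only [← mul_div_assoc, ← Finset.sum_div, mul_sub, mul_one, Finset.sum_sub_distrib]
    exact div_nonneg (sub_nonneg.2 (by simpa only [mul_div_assoc] using hsum))
      (Real.log_pos one_lt_two).le
  have hle := hnonneg.trans (Finset.sum_le_sum fun ω _ => hpt ω)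
  simp only [ent_eq_sum, ← Finset.sum_add_distrib]
  rw [← sub_nonneg, ← Finset.sum_sub_distrib]
  refine hle.trans_eq (Finset.sum_congr rfl fun ω _ => ?_)
  ring

end EntropyLemmas

end JWE

open JWE

/-- If U^N is independent of K^n and Z^n is conditionally independent of U^N
given (Y^n, K^n), then H(Y^n|K^n) ≥ H(Y^n|U^N,K^n) + I(U^N;Z^n,K^n). -/
theorem statement9 {Ω 𝒰 𝒦 𝒴 𝒵 : Type*} [Fintype Ω]
    [Fintype 𝒰] [DecidableEq 𝒰] [Fintype 𝒦] [DecidableEq 𝒦]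
    [Fintype 𝒴] [DecidableEq 𝒴] [Fintype 𝒵] [DecidableEq 𝒵]
    (μ : Ω → ℝ) (hμ : IsPMF μ)
    (U : Ω → 𝒰) (K : Ω → 𝒦) (Y : Ω → 𝒴) (Z : Ω → 𝒵)
    (hUK : IndepRV μ U K)
    (hMarkov : CondIndep μ U Z (fun ω => (Y ω, K ω))) :
    condEnt μ Y K ≥
      condEnt μ Y (fun ω => (U ω, K ω)) + mutInf μ U (fun ω => (Z ω, K ω)) := by
  have hadd := hUK.ent_prodMk hμ.1
  have hmarkov := hMarkov.ent_add_ent hμ.1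
  have hsub := ent_add_ent_le hμ.1 U Y (fun ω => (Z ω, K ω))
  have hUYZK : ent μ (fun ω => ((U ω, Z ω), (Y ω, K ω))) =
      ent μ (fun ω => ((U ω, Y ω), (Z ω, K ω))) :=
    ent_comp_of_injective (Equiv.prodProdProdComm 𝒰 𝒴 𝒵 𝒦).injective
      (fun ω => ((U ω, Y ω), (Z ω, K ω)))
  have hYZK : ent μ (fun ω => (Z ω, Y ω, K ω)) = ent μ (fun ω => (Y ω, Z ω, K ω)) :=
    ent_comp_of_injective prodLeftComm_injective (fun ω => (Y ω, Z ω, K ω))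
  have hUYK : ent μ (fun ω => (Y ω, U ω, K ω)) = ent μ (fun ω => (U ω, Y ω, K ω)) :=
    ent_comp_of_injective prodLeftComm_injective (fun ω => (U ω, Y ω, K ω))
  simp only [condEnt, mutInf]
  linarith

end
end

section
/- For all real numbers 0 < a < b and every n ≥ 1, the binary divergence satisfies D(2^{−na} ∥ 2^{−nb}) ≥ [n(b − a) − log₂ e] · 2^{−na}. -/
open Finset

noncomputable section

open JWE

/-- The binary divergence D(α‖β) (in bits). -/
noncomputable def binDiv (α β : ℝ) : ℝ :=
  α * Real.logb 2 (α / β) + (1 - α) * Real.logb 2 ((1 - α) / (1 - β))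

/-- For `α < 1` and `0 ≤ β < 1`, the binary divergence is at least
`α (log₂ (α / β) - log₂ e)`. -/
theorem mul_logb_div_sub_le_binDiv {α β : ℝ} (hα : α < 1) (hβ : 0 ≤ β) (hβ' : β < 1) :
    α * (Real.logb 2 (α / β) - Real.logb 2 (Real.exp 1)) ≤ binDiv α β := by
  have hα' : 0 < 1 - α := sub_pos.2 hα
  have hβ'' : 0 < 1 - β := sub_pos.2 hβ'
  have hlog : -α ≤ (1 - α) * Real.log ((1 - α) / (1 - β)) := by
    have h := mul_le_mul_of_nonneg_left
      (Real.one_sub_inv_le_log_of_pos (div_pos hα' hβ'')) hα'.le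
    have he : (1 - α) * (1 - ((1 - α) / (1 - β))⁻¹) = β - α := by
      field_simp
      ring
    linarith
  have hlogb := div_le_div_of_nonneg_right hlog (Real.log_pos one_lt_two).le
  have he : Real.logb 2 (Real.exp 1) = 1 / Real.log 2 := by simp [Real.logb]
  have hr : (1 - α) * Real.log ((1 - α) / (1 - β)) / Real.log 2 =
      (1 - α) * Real.logb 2 ((1 - α) / (1 - β)) := mul_div_assoc _ _ _
  have hl : -α / Real.log 2 = -(α * (1 / Real.log 2)) := by ring
  rw [binDiv, he]
  linarith

/-- For all 0 < a < b and n ≥ 1,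
D(2^{−na} ∥ 2^{−nb}) ≥ [n(b − a) − log₂ e] · 2^{−na}. -/
theorem statement16 (a b : ℝ) (n : ℕ) (ha : 0 < a) (hab : a < b) (hn : 1 ≤ n) :
    binDiv ((2 : ℝ) ^ (-(n : ℝ) * a)) ((2 : ℝ) ^ (-(n : ℝ) * b)) ≥
      ((n : ℝ) * (b - a) - Real.logb 2 (Real.exp 1)) * (2 : ℝ) ^ (-(n : ℝ) * a) := by
  have hn' : (0 : ℝ) < n := by exact_mod_cast hn
  have lt_one : ∀ c : ℝ, 0 < c → (2 : ℝ) ^ (-(n : ℝ) * c) < 1 := fun c hc =>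
    Real.rpow_lt_one_of_one_lt_of_neg one_lt_two (by nlinarith)
  have hratio : Real.logb 2 ((2 : ℝ) ^ (-(n : ℝ) * a) / (2 : ℝ) ^ (-(n : ℝ) * b)) =
      n * (b - a) := by
    rw [← Real.rpow_sub two_pos, Real.logb_rpow two_pos (by norm_num)]
    ring
  have h := mul_logb_div_sub_le_binDiv (lt_one a ha)
    (Real.rpow_nonneg zero_le_two (-(n : ℝ) * b)) (lt_one b (ha.trans hab))
  rwa [hratio, mul_comm] at h

end
end
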